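/- arXiv:1405.7913 — 3 statements merged into one kernel-verified Lean document; each statement's English description precedes it below -/
import Mathlib

section
/- Let 0 < λ < 2 and let z = (x,y) ∈ ℤ² with x ≥ 0, y ≥ 0 and x + y < 1/λ. Then the orbit of z under F is symmetric and periodic, with minimal period 4(x+y)+1. -/
open Filter Topology

/-- The discretised rotation `F(x,y) = (⌊λx⌋ − y, x)` as a permutation of `ℤ²`. -/
noncomputable def Fe (lam : ℝ) : Equiv.Perm (ℤ × ℤ) where
  toFun p := (⌊lam * p.1⌋ - p.2, p.1)
  invFun p := (p.2, ⌊lam * p.2⌋ - p.1)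
  left_inv p := by simp
  right_inv p := by simp

/-- The (two-sided) orbit `O(z) = {Fᵏ(z) : k ∈ ℤ}`. -/
noncomputable def orbitSet (lam : ℝ) (p : ℤ × ℤ) : Set (ℤ × ℤ) :=
  {q | ∃ k : ℤ, q = (Fe lam ^ k) p}

/-- The reflection `G(x,y) = (y,x)`. -/
def Gmap (p : ℤ × ℤ) : ℤ × ℤ := (p.2, p.1)

lemma Fe_apply (lam : ℝ) (a b : ℤ) : Fe lam (a, b) = (⌊lam * a⌋ - b, a) := rfl

lemma floor_nonneg_case (lam : ℝ) (h0 : 0 < lam) (n : ℕ) (hn : lam * n < 1) (a : ℤ)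
    (ha : 0 ≤ a) (han : a ≤ n) : ⌊lam * (a : ℝ)⌋ = 0 := by
  have h1 : (0 : ℝ) ≤ a := by exact_mod_cast ha
  have h2 : (a : ℝ) ≤ n := by exact_mod_cast han
  rw [Int.floor_eq_iff]
  push_cast
  constructor
  · positivity
  · nlinarith

lemma floor_neg_case (lam : ℝ) (h0 : 0 < lam) (n : ℕ) (hn : lam * n < 1) (a : ℤ)
    (ha : a < 0) (han : -(n : ℤ) ≤ a) : ⌊lam * (a : ℝ)⌋ = -1 := by
  have h1 : (a : ℝ) < 0 := by exact_mod_cast ha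
  have h2 : -(n : ℝ) ≤ a := by exact_mod_cast han
  rw [Int.floor_eq_iff]
  push_cast
  constructor
  · nlinarith
  · nlinarith

lemma steps (lam : ℝ) (h0 : 0 < lam) (n : ℕ) (hn : lam * n < 1) (a b : ℤ)
    (ha : 0 ≤ a) (hb : 1 ≤ b) (hab : a + b = n) :
    Fe lam (a, b) = (-b, a) ∧ Fe lam (-b, a) = (-1 - a, -b) ∧
    Fe lam (-1 - a, -b) = (b - 1, -1 - a) ∧ Fe lam (b - 1, -1 - a) = (a + 1, b - 1) := by
  refine ⟨?_, ?_, ?_, ?_⟩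
  · rw [Fe_apply, floor_nonneg_case lam h0 n hn a (by omega) (by omega)]; simp
  · rw [Fe_apply, floor_neg_case lam h0 n hn _ (by omega) (by omega)]
  · rw [Fe_apply, floor_neg_case lam h0 n hn _ (by omega) (by omega)]; ext <;> simp; ring
  · rw [Fe_apply, floor_nonneg_case lam h0 n hn _ (by omega) (by omega)]; ext <;> simp

lemma iter4 (lam : ℝ) (h0 : 0 < lam) (n : ℕ) (hn : lam * n < 1) (j : ℕ) (hj : j ≤ n) :
    (Fe lam)^[4 * j] (0, (n : ℤ)) = ((j : ℤ), (n : ℤ) - j) := by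
  induction j with
  | zero => simp
  | succ j ih =>
    obtain ⟨s1, s2, s3, s4⟩ := steps lam h0 n hn (j : ℤ) ((n : ℤ) - j) (by omega) (by omega)
      (by omega)
    rw [show 4 * (j + 1) = 4 * j + 1 + 1 + 1 + 1 by ring]
    simp only [Function.iterate_succ_apply']
    rw [ih (by omega), s1, s2, s3, s4]
    ext <;> simp; ring

lemma iter_full (lam : ℝ) (h0 : 0 < lam) (n : ℕ) (hn : lam * n < 1) :
    (Fe lam)^[4 * n + 1] (0, (n : ℤ)) = (0, (n : ℤ)) := by
  rw [Function.iterate_succ_apply', iter4 lam h0 n hn n le_rfl, Fe_apply,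
    floor_nonneg_case lam h0 n hn _ (by omega) (by omega)]
  simp

lemma iter_ne (lam : ℝ) (h0 : 0 < lam) (n : ℕ) (hn : lam * n < 1) (d : ℕ) (hd : 0 < d)
    (hdn : d < 4 * n + 1) : (Fe lam)^[d] (0, (n : ℤ)) ≠ (0, (n : ℤ)) := by
  intro h
  obtain ⟨j, r, hr, rfl⟩ : ∃ j r, r < 4 ∧ d = 4 * j + r :=
    ⟨d / 4, d % 4, Nat.mod_lt _ (by norm_num), (Nat.div_add_mod d 4).symm⟩
  have hi := iter4 lam h0 n hn j (by omega)
  by_cases hr0 : r = 0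
  · subst hr0
    rw [add_zero, hi, Prod.mk.injEq] at h
    omega
  obtain ⟨s1, s2, s3, s4⟩ := steps lam h0 n hn (j : ℤ) ((n : ℤ) - j) (by omega) (by omega)
    (by omega)
  have : r = 1 ∨ r = 2 ∨ r = 3 := by omega
  rcases this with rfl | rfl | rfl
  · rw [Function.iterate_succ_apply', hi, s1, Prod.mk.injEq] at h
    omega
  · rw [show 4 * j + 2 = 4 * j + 1 + 1 by ring] at h
    simp only [Function.iterate_succ_apply'] at h
    rw [hi, s1, s2, Prod.mk.injEq] at h
    omega
  · rw [show 4 * j + 3 = 4 * j + 1 + 1 + 1 by ring] at h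
    simp only [Function.iterate_succ_apply'] at h
    rw [hi, s1, s2, s3, Prod.mk.injEq] at h
    omega

lemma minPer (lam : ℝ) (h0 : 0 < lam) (n : ℕ) (hn : lam * n < 1) :
    Function.minimalPeriod (Fe lam) (0, (n : ℤ)) = 4 * n + 1 := by
  have hp : Function.IsPeriodicPt (Fe lam) (4 * n + 1) (0, (n : ℤ)) := iter_full lam h0 n hn
  refine le_antisymm (hp.minimalPeriod_le (by omega)) ?_
  by_contra hlt
  exact iter_ne lam h0 n hn _ (hp.minimalPeriod_pos (by omega)) (not_le.mp hlt)
    (Function.isPeriodicPt_minimalPeriod _ _)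

lemma Gmap_Gmap (p : ℤ × ℤ) : Gmap (Gmap p) = p := rfl

lemma Gmap_Fe (lam : ℝ) (p : ℤ × ℤ) : Gmap (Fe lam p) = (Fe lam)⁻¹ (Gmap p) := by
  rw [Equiv.Perm.eq_inv_iff_eq]
  obtain ⟨a, b⟩ := p
  simp [Gmap, Fe_apply]

lemma Gmap_zpow (lam : ℝ) (k : ℤ) (p : ℤ × ℤ) :
    Gmap ((Fe lam ^ k) p) = (Fe lam ^ (-k)) (Gmap p) := by
  let g : Equiv.Perm (ℤ × ℤ) := ⟨Gmap, Gmap, Gmap_Gmap, Gmap_Gmap⟩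
  have h1 : SemiconjBy g (Fe lam) (Fe lam)⁻¹ := by
    ext1 p
    exact Gmap_Fe lam p
  have h2 := h1.zpow_right k
  have h3 := congrArg (fun e : Equiv.Perm (ℤ × ℤ) => e p) h2.eq
  rw [zpow_neg, ← inv_zpow]
  exact h3

theorem orbit_symmetric_and_minimalPeriod (lam : ℝ) (hlam0 : 0 < lam) (hlam2 : lam < 2)
    (x y : ℤ) (hx : 0 ≤ x) (hy : 0 ≤ y) (hxy : (x : ℝ) + (y : ℝ) < 1 / lam) :
    Gmap '' orbitSet lam (x, y) = orbitSet lam (x, y) ∧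
    Function.minimalPeriod (⇑(Fe lam)) (x, y) = (4 * (x + y) + 1).toNat := by
  lift x to ℕ using hx
  lift y to ℕ using hy
  have hn : lam * ((x + y : ℕ) : ℝ) < 1 := by
    rw [lt_div_iff₀ hlam0] at hxy
    push_cast at hxy ⊢
    linarith
  have e1 := iter4 lam hlam0 (x + y) hn x (by omega)
  have e2 := iter4 lam hlam0 (x + y) hn y (by omega)
  rw [show (((x + y : ℕ) : ℤ) - (x : ℤ)) = y by omega] at e1
  rw [show (((x + y : ℕ) : ℤ) - (y : ℤ)) = x by omega] at e2
  constructor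
  · have e3 : Gmap ((x : ℤ), (y : ℤ)) =
        (Fe lam ^ (((4 * y : ℕ) : ℤ) - ((4 * x : ℕ) : ℤ))) ((x : ℤ), (y : ℤ)) := by
      rw [← e1, Equiv.Perm.iterate_eq_pow, ← zpow_natCast, ← Equiv.Perm.mul_apply, ← zpow_add,
        sub_add_cancel, zpow_natCast, zpow_natCast, ← Equiv.Perm.iterate_eq_pow,
        ← Equiv.Perm.iterate_eq_pow, e1, e2]
      rfl
    have key : ∀ p ∈ orbitSet lam ((x : ℤ), (y : ℤ)),
        Gmap p ∈ orbitSet lam ((x : ℤ), (y : ℤ)) := by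
      rintro p ⟨k, rfl⟩
      refine ⟨-k + (((4 * y : ℕ) : ℤ) - ((4 * x : ℕ) : ℤ)), ?_⟩
      rw [Gmap_zpow, e3, ← Equiv.Perm.mul_apply, ← zpow_add]
    ext p
    constructor
    · rintro ⟨q, hq, rfl⟩
      exact key q hq
    · intro hp
      exact ⟨Gmap p, key p hp, rfl⟩
  · rw [← e1, Function.minimalPeriod_apply_iterate, minPer lam hlam0 (x + y) hn]
    · omega
    · exact ⟨_, by omega, iter_full lam hlam0 (x + y) hn⟩
end

section
/- For every r > 0, the ratio μ₁(r,λ) = #{z ∈ A(r,λ) : v(z) = λ·𝐰(z)} / #A(r,λ) tends to 1 as λ → 0⁺. -/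
open Filter Topology

/-- The point of `(λℤ)² ⊂ ℝ²` with lattice index `p ∈ ℤ²`. -/
noncomputable def pt (lam : ℝ) (p : ℤ × ℤ) : ℝ × ℝ := (lam * p.1, lam * p.2)

/-- The auxiliary vector field `𝐰(x,y) = (2⌊y⌋+1, −(2⌊x⌋+1))`. -/
noncomputable def wfield (q : ℝ × ℝ) : ℤ × ℤ := (2*⌊q.2⌋+1, -(2*⌊q.1⌋+1))

/-- The condition `v(z) = λ·𝐰(z)` for the lattice point `z = λ·p`, where
`v(z) = F_λ⁴(z) − z` is the discrete vector field of the rescaled map `F_λ`. -/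
def vcond (lam : ℝ) (p : ℤ × ℤ) : Prop :=
  pt lam ((Fe lam ^ 4) p) - pt lam p
    = lam • ((((wfield (pt lam p)).1 : ℝ)), (((wfield (pt lam p)).2 : ℝ)))

/-- The set `A(r,λ) = {z ∈ (λℤ)² : ‖z‖∞ < r}`, described by lattice indices. -/
def Aset (r lam : ℝ) : Set (ℤ × ℤ) := {p | max |lam * p.1| |lam * p.2| < r}

/-- The ratio `μ₁(r,λ) = #{z ∈ A(r,λ) : v(z) = λ𝐰(z)} / #A(r,λ)`. -/
noncomputable def mu1 (r lam : ℝ) : ℝ :=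
  ({p | p ∈ Aset r lam ∧ vcond lam p} : Set (ℤ × ℤ)).ncard / (Aset r lam).ncard

lemma vcond_of_good (R : ℕ) (lam : ℝ) (hl : 0 < lam) (p : ℤ × ℤ)
    (hx : |lam * p.1| < R) (hy : |lam * p.2| < R)
    (gx : ∀ k : ℤ, lam * (2 * R + 1) < |lam * p.1 - k|)
    (gy : ∀ k : ℤ, lam * (2 * R + 1) < |lam * p.2 - k|) : vcond lam p := by
  obtain ⟨x, y⟩ := p
  simp only at hx hy gx gy
  have key : ∀ t : ℝ, |t| < R → (∀ k : ℤ, lam * (2 * R + 1) < |t - k|) →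
      ((⌊t⌋ : ℝ) + lam * (2 * R + 1) < t ∧ t < ⌊t⌋ + 1 - lam * (2 * R + 1)) ∧
      (-(R : ℝ) ≤ ⌊t⌋ ∧ (⌊t⌋ : ℝ) ≤ R) := by
    intro t ht g
    have h1 := Int.floor_le t
    have h2 := Int.lt_floor_add_one t
    have g1 := g ⌊t⌋
    have g2 := g (⌊t⌋ + 1)
    push_cast at g2
    rw [abs_of_nonneg (by linarith)] at g1
    rw [abs_of_neg (by linarith)] at g2
    obtain ⟨h3, h4⟩ := abs_lt.1 ht
    have h5 : (-(R : ℤ)) ≤ ⌊t⌋ := Int.le_floor.2 (by push_cast; linarith)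
    have h5' : ((-(R : ℤ) : ℤ) : ℝ) ≤ (⌊t⌋ : ℝ) := by exact_mod_cast h5
    push_cast at h5'
    exact ⟨⟨by linarith, by linarith⟩, h5', by linarith⟩
  obtain ⟨⟨a1, a2⟩, a3, a4⟩ := key _ hx gx
  obtain ⟨⟨m1, m2⟩, m3, m4⟩ := key _ hy gy
  generalize ha : ⌊lam * (x : ℝ)⌋ = a at *
  generalize hm : ⌊lam * (y : ℝ)⌋ = m at *
  have hR : (0 : ℝ) ≤ R := Nat.cast_nonneg R
  have bd : ∀ s : ℝ, -(2 * R + 1) ≤ s → s ≤ 2 * R + 1 →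
      -(lam * (2 * R + 1)) ≤ lam * s ∧ lam * s ≤ lam * (2 * R + 1) := by
    intro s h1 h2
    constructor <;> nlinarith
  have hb : ⌊lam * ((a - y : ℤ) : ℝ)⌋ = -m - 1 := by
    obtain ⟨h1, h2⟩ := bd a (by linarith) (by linarith)
    rw [Int.floor_eq_iff]; push_cast
    constructor <;> linarith
  have hc : ⌊lam * ((-m - 1 - x : ℤ) : ℝ)⌋ = -a - 1 := by
    obtain ⟨h1, h2⟩ := bd (-m - 1) (by linarith) (by linarith)
    rw [Int.floor_eq_iff]; push_cast
    constructor <;> linarith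
  have hd : ⌊lam * ((-a - 1 - (a - y) : ℤ) : ℝ)⌋ = m := by
    obtain ⟨h1, h2⟩ := bd (-2 * a - 1) (by linarith) (by linarith)
    rw [Int.floor_eq_iff]; push_cast
    constructor <;> linarith
  have hF : (Fe lam ^ 4) (x, y) = (m - (-m - 1 - x), -a - 1 - (a - y)) := by
    have e1 : Fe lam (x, y) = (a - y, x) := by simp [Fe, ha]
    have e2 : Fe lam (a - y, x) = (-m - 1 - x, a - y) := by
      show (⌊lam * ((a - y : ℤ) : ℝ)⌋ - x, a - y) = _
      rw [hb]
    have e3 : Fe lam (-m - 1 - x, a - y) = (-a - 1 - (a - y), -m - 1 - x) := by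
      show (⌊lam * ((-m - 1 - x : ℤ) : ℝ)⌋ - (a - y), -m - 1 - x) = _
      rw [hc]
    have e4 : Fe lam (-a - 1 - (a - y), -m - 1 - x)
        = (m - (-m - 1 - x), -a - 1 - (a - y)) := by
      show (⌊lam * ((-a - 1 - (a - y) : ℤ) : ℝ)⌋ - (-m - 1 - x), -a - 1 - (a - y)) = _
      rw [hd]
    simp only [pow_succ, pow_zero, one_mul, Equiv.Perm.mul_apply]
    rw [e1, e2, e3, e4]
  unfold vcond
  rw [hF]
  simp only [pt, wfield, ha, hm]
  ext
  · simp; ring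
  · simp; ring

/-- One-dimensional index set. -/
def Xset (r lam : ℝ) : Set ℤ := {x | |lam * x| < r}

/-- Indices whose point is close to an integer. -/
def Bset (R : ℕ) (r lam : ℝ) : Set ℤ :=
  {x | x ∈ Xset r lam ∧ ∃ k : ℤ, |lam * x - k| ≤ lam * (2 * R + 1)}

lemma Xset_finite (r lam : ℝ) (hl : 0 < lam) : (Xset r lam).Finite := by
  apply (Set.finite_Icc (-⌈r / lam⌉) ⌈r / lam⌉).subset
  intro x hx
  obtain ⟨h1, h2⟩ := abs_lt.1 (show |lam * (x : ℝ)| < r from hx)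
  have h3 : (x : ℝ) < r / lam := by rw [lt_div_iff₀ hl]; linarith
  have h4 : -(x : ℝ) < r / lam := by rw [lt_div_iff₀ hl]; linarith
  have h5 := Int.le_ceil (r / lam)
  constructor
  · have : -(x : ℝ) ≤ ⌈r / lam⌉ := by linarith
    have : -x ≤ ⌈r / lam⌉ := by exact_mod_cast this
    linarith
  · have : (x : ℝ) ≤ ⌈r / lam⌉ := by linarith
    exact_mod_cast this

lemma Xset_card (r lam : ℝ) (hl : 0 < lam) :
    r / lam ≤ (Xset r lam).ncard := by
  have hsub : (fun n : ℕ => (n : ℤ)) '' (Finset.range ⌈r / lam⌉₊ : Set ℕ) ⊆ Xset r lam := by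
    rintro _ ⟨n, hn, rfl⟩
    have hn' : n < ⌈r / lam⌉₊ := by simpa using hn
    have h := Nat.lt_ceil.1 hn'
    rw [lt_div_iff₀ hl] at h
    show |lam * ((n : ℤ) : ℝ)| < r
    rw [abs_of_nonneg (by positivity)]
    push_cast; linarith
  have h1 := Set.ncard_le_ncard hsub (Xset_finite r lam hl)
  rw [Set.ncard_image_of_injective _ Nat.cast_injective, Set.ncard_coe_finset,
    Finset.card_range] at h1
  exact (Nat.le_ceil _).trans (by exact_mod_cast h1)

lemma Bset_card (R : ℕ) (r lam : ℝ) (hl : 0 < lam) (hrR : r ≤ R)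
    (hs : lam * (2 * R + 1) ≤ 1) :
    (Bset R r lam).ncard ≤
      ((Finset.Icc (-(R + 1) : ℤ) (R + 1)) ×ˢ (Finset.Icc (-(2 * R + 2) : ℤ) (2 * R + 2))).card := by
  classical
  have hsub : Bset R r lam ⊆ (((Finset.Icc (-(R + 1) : ℤ) (R + 1)) ×ˢ
      (Finset.Icc (-(2 * R + 2) : ℤ) (2 * R + 2))).image
        (fun q => ⌊(q.1 : ℝ) / lam⌋ + q.2) : Finset ℤ) := by
    rintro x ⟨hx, k, hk⟩
    obtain ⟨h1, h2⟩ := abs_lt.1 (show |lam * (x : ℝ)| < r from hx)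
    obtain ⟨h3, h4⟩ := abs_le.1 hk
    simp only [Finset.coe_image, Set.mem_image]
    refine ⟨(k, x - ⌊(k : ℝ) / lam⌋), ?_, by simp⟩
    have f1 := Int.floor_le ((k : ℝ) / lam)
    have f2 := Int.lt_floor_add_one ((k : ℝ) / lam)
    have e1 : (x : ℝ) - k / lam ≤ 2 * R + 1 := by
      have : lam * (x - k / lam) ≤ lam * (2 * R + 1) := by
        rw [mul_sub, mul_div_cancel₀ _ hl.ne']; exact h4
      exact le_of_mul_le_mul_left this hl
    have e2 : -(2 * R + 1 : ℝ) ≤ (x : ℝ) - k / lam := by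
      have : lam * (-(2 * R + 1)) ≤ lam * (x - k / lam) := by
        rw [mul_sub, mul_div_cancel₀ _ hl.ne']; linarith
      exact le_of_mul_le_mul_left this hl
    have k1 : (k : ℝ) ≤ R + 1 := by linarith
    have k2 : -(R + 1 : ℝ) ≤ k := by linarith
    have k3 : (x : ℝ) - ⌊(k : ℝ) / lam⌋ ≤ 2 * R + 2 := by linarith
    have k4 : -(2 * R + 2 : ℝ) ≤ (x : ℝ) - ⌊(k : ℝ) / lam⌋ := by linarith
    simp only [Finset.mem_coe, Finset.mem_product, Finset.mem_Icc]
    exact ⟨⟨by exact_mod_cast k2, by exact_mod_cast k1⟩,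
      ⟨by exact_mod_cast k4, by exact_mod_cast k3⟩⟩
  have h1 := Set.ncard_le_ncard hsub (Finset.finite_toSet _)
  rw [Set.ncard_coe_finset] at h1
  exact h1.trans Finset.card_image_le

lemma Aset_eq (r lam : ℝ) : Aset r lam = Xset r lam ×ˢ Xset r lam := by
  ext p
  simp [Aset, Xset, Set.mem_prod]

lemma mu1_lower (R : ℕ) (r lam : ℝ) (C : ℕ) (hr : 0 < r) (hl : 0 < lam) (hrR : r ≤ R)
    (hC : (Bset R r lam).ncard ≤ C) : 1 - 2 * C / r * lam ≤ mu1 r lam := by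
  have hX := Xset_finite r lam hl
  have hBX : Bset R r lam ⊆ Xset r lam := fun x hx => hx.1
  have hB : (Bset R r lam).Finite := hX.subset hBX
  have hA : (Aset r lam).Finite := by rw [Aset_eq]; exact hX.prod hX
  have hG : ({p | p ∈ Aset r lam ∧ vcond lam p} : Set (ℤ × ℤ)).Finite :=
    hA.subset fun p hp => hp.1
  have hsub : Aset r lam ⊆ {p | p ∈ Aset r lam ∧ vcond lam p} ∪
      (Bset R r lam ×ˢ Xset r lam ∪ Xset r lam ×ˢ Bset R r lam) := by
    intro p hp
    have hp' := hp
    rw [Aset_eq] at hp'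
    by_cases h1 : p.1 ∈ Bset R r lam
    · exact Or.inr (Or.inl ⟨h1, hp'.2⟩)
    by_cases h2 : p.2 ∈ Bset R r lam
    · exact Or.inr (Or.inr ⟨hp'.1, h2⟩)
    refine Or.inl ⟨hp, vcond_of_good R lam hl p (lt_of_lt_of_le hp'.1 hrR)
      (lt_of_lt_of_le hp'.2 hrR) ?_ ?_⟩
    · intro k
      by_contra h
      exact h1 ⟨hp'.1, k, not_lt.1 h⟩
    · intro k
      by_contra h
      exact h2 ⟨hp'.2, k, not_lt.1 h⟩
  have hc := Set.ncard_le_ncard hsub (hG.union ((hB.prod hX).union (hX.prod hB)))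
  have hc2 := hc.trans (Set.ncard_union_le _ _)
  have hc3 := Set.ncard_union_le (Bset R r lam ×ˢ Xset r lam) (Xset r lam ×ˢ Bset R r lam)
  rw [Set.ncard_prod, Set.ncard_prod] at hc3
  have hAc : (Aset r lam).ncard = (Xset r lam).ncard * (Xset r lam).ncard := by
    rw [Aset_eq, Set.ncard_prod]
  have hN := Xset_card r lam hl
  unfold mu1
  rw [hAc] at hc2 ⊢
  generalize (Xset r lam).ncard = N at *
  generalize (Bset R r lam).ncard = b at *
  generalize Set.ncard {p | p ∈ Aset r lam ∧ vcond lam p} = g at *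
  have hfin : N * N ≤ g + 2 * (C * N) := by
    have : b * N ≤ C * N := Nat.mul_le_mul_right _ hC
    have : N * b = b * N := Nat.mul_comm _ _
    omega
  have hfin' : (N : ℝ) * N ≤ g + 2 * (C * N) := by exact_mod_cast hfin
  have hNpos : (0 : ℝ) < N := lt_of_lt_of_le (div_pos hr hl) hN
  have hNr : r ≤ lam * N := by rw [div_le_iff₀ hl] at hN; linarith
  push_cast
  rw [le_div_iff₀ (by positivity)]
  have h1 : (1 : ℝ) ≤ lam * N / r := by rw [le_div_iff₀ hr]; linarith
  have h2 : 2 * (C * N : ℝ) * 1 ≤ 2 * (C * N) * (lam * N / r) :=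
    mul_le_mul_of_nonneg_left h1 (by positivity)
  have h3 : (1 - 2 * C / r * lam) * (N * N : ℝ) = N * N - 2 * (C * N) * (lam * N / r) := by
    field_simp
  rw [h3]; linarith

lemma mu1_upper (r lam : ℝ) (hl : 0 < lam) : mu1 r lam ≤ 1 := by
  have hX := Xset_finite r lam hl
  have hA : (Aset r lam).Finite := by rw [Aset_eq]; exact hX.prod hX
  unfold mu1
  apply div_le_one_of_le₀ _ (Nat.cast_nonneg _)
  have hsub : ({p | p ∈ Aset r lam ∧ vcond lam p} : Set (ℤ × ℤ)) ⊆ Aset r lam :=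
    fun p hp => hp.1
  exact_mod_cast Set.ncard_le_ncard hsub hA

/-- For every `r > 0`, `μ₁(r,λ) → 1` as `λ → 0⁺`. -/
theorem mu1_tendsto_one (r : ℝ) (hr : 0 < r) :
    Tendsto (fun lam => mu1 r lam) (nhdsWithin 0 (Set.Ioi 0)) (nhds 1) := by
  obtain ⟨R, hR⟩ := exists_nat_ge r
  let C : ℕ := ((Finset.Icc (-(R + 1) : ℤ) (R + 1)) ×ˢ
    (Finset.Icc (-(2 * R + 2) : ℤ) (2 * R + 2))).card
  have hlim : Tendsto (fun lam : ℝ => 1 - 2 * (C : ℝ) / r * lam)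
      (nhdsWithin 0 (Set.Ioi 0)) (nhds 1) := by
    have hcont : Continuous (fun lam : ℝ => 1 - 2 * (C : ℝ) / r * lam) := by fun_prop
    have h := hcont.tendsto 0
    simp only [mul_zero, sub_zero] at h
    exact h.mono_left nhdsWithin_le_nhds
  refine tendsto_of_tendsto_of_tendsto_of_le_of_le' hlim tendsto_const_nhds ?_ ?_
  · have hpos : (0 : ℝ) < 1 / (2 * R + 1) := by positivity
    filter_upwards [Ioo_mem_nhdsGT hpos] with lam hlam
    have hs : lam * (2 * R + 1) ≤ 1 := by
      have := hlam.2
      rw [lt_div_iff₀ (by positivity)] at this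
      exact this.le
    exact mu1_lower R r lam C hr hlam.1 hR (Bset_card R r lam hlam.1 hR hs)
  · filter_upwards [self_mem_nhdsWithin] with lam hlam
    exact mu1_upper r lam hlam
end

section
/- For every r > 0 there exists λ* > 0 such that for all 0 < λ < λ* and all z ∈ A(r,λ): if z ∉ Λ and z ≠ (0,0), then v(z) = λ·𝐰(z). -/
open Filter Topology

/-- The round-off map `R(x,y) = (⌊x⌋, ⌊y⌋)`. -/
noncomputable def Rmap (q : ℝ × ℝ) : ℤ × ℤ := (⌊q.1⌋, ⌊q.2⌋)

/-- `z = λ·p` is a transition point: `R(F_λ⁴(z)) ≠ R(z)`; these form the set `Λ`. -/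
def IsTransition (lam : ℝ) (p : ℤ × ℤ) : Prop :=
  Rmap (pt lam ((Fe lam ^ 4) p)) ≠ Rmap (pt lam p)


lemma vcond_core (l r : ℝ) (hl : 0 < l) (hlr : l * (r + 3) < 1) (hr : 0 < r)
    (x y a b c e : ℤ) (hx : |l * x| < r) (hy : |l * y| < r) (hne : ¬ (x = 0 ∧ y = 0))
    (ha1 : (a:ℝ) ≤ l * x) (ha2 : l * x < a + 1)
    (he1 : (e:ℝ) ≤ l * y) (he2 : l * y < e + 1)
    (hb1 : (b:ℝ) ≤ l * (a - y)) (hb2 : l * (a - y) < b + 1)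
    (hc1 : (c:ℝ) ≤ l * (b - x)) (hc2 : l * (b - x) < c + 1)
    (ht1 : (e:ℝ) ≤ l * (c - a + y)) (ht2 : l * (c - a + y) < e + 1)
    (hs1 : (a:ℝ) ≤ l * (e - b + x)) (hs2 : l * (e - b + x) < a + 1) :
    b = -e - 1 ∧ c = -a - 1 := by
  have key : ∀ m n : ℤ, l * m < l * n → m < n := fun m n h => by
    exact_mod_cast lt_of_mul_lt_mul_left h hl.le
  have key' : ∀ m n : ℤ, l * m ≤ l * n → m ≤ n := fun m n h => by
    exact_mod_cast le_of_mul_le_mul_left h hl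
  have mono : ∀ m n : ℤ, m ≤ n → l * m ≤ l * n := fun m n h =>
    mul_le_mul_of_nonneg_left (by exact_mod_cast h) hl.le
  have smono : ∀ m n : ℤ, m < n → l * m < l * n := fun m n h =>
    mul_lt_mul_of_pos_left (by exact_mod_cast h) hl
  obtain ⟨hx1, hx2⟩ := abs_lt.mp hx
  obtain ⟨hy1, hy2⟩ := abs_lt.mp hy
  have la1 : l * a < 1 := by nlinarith
  have la2 : -1 < l * a := by nlinarith
  have lb1 : l * b < 1 := by nlinarith
  have lb2 : -1 < l * b := by nlinarith
  have hb : b = -e - 1 := by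
    by_contra hbn
    have : l * (y - a) ≤ e ∨ e + 1 < l * (y - a) := by
      by_contra! h
      apply hbn
      have h1 : (b:ℝ) < -e := by linarith
      have h2 : (-e - 1 : ℝ) < b + 1 := by linarith
      have h1' : b < -e := by exact_mod_cast h1
      have h2' : -e - 1 < b + 1 := by exact_mod_cast h2
      omega
    rcases this with h | h
    · have a0 : 0 ≤ a := key' 0 a (by push_cast; linarith)
      have c0 : 0 ≤ c := key' 0 c (by push_cast; linarith)
      have hca : (c:ℝ) < -a + 1 := by linarith
      have hca' : c < -a + 1 := by exact_mod_cast hca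
      have a00 : a = 0 := by omega
      have c00 : c = 0 := by omega
      subst a00 c00
      push_cast at *
      have hbe : b = -e := by
        have h1 : (b:ℝ) ≤ -e := by linarith
        have h2 : (-e : ℝ) < b + 1 := by linarith
        have h1' : b ≤ -e := by exact_mod_cast h1
        have h2' : -e < b + 1 := by exact_mod_cast h2
        omega
      have x0 : 0 ≤ x := key' 0 x (by push_cast; linarith)
      have xb : x ≤ b := key' x b (by linarith)
      have xb2 : 0 ≤ e - b + x := key' 0 _ (by push_cast; linarith)
      have e0 : e = 0 := by omega
      have xx : x = 0 := by omega
      subst e0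
      push_cast at *
      have y1 : y ≤ 0 := key' y 0 (by push_cast; linarith)
      have y2 : 0 ≤ y := key' 0 y (by push_cast; linarith)
      exact hne ⟨xx, by omega⟩
    · have a0 : a < 0 := key a 0 (by push_cast; linarith)
      have c0 : c < 0 := key c 0 (by push_cast; linarith)
      have hca : (-a - 2:ℝ) < c + 1 := by linarith
      have hca' : -a - 2 < c + 1 := by exact_mod_cast hca
      have h3 : c = -1 ∨ (a = -1 ∧ c = -1) := by omega
      have c1 : c = -1 := by omega
      have a1 : a = -1 := by
        by_contra hh
        have h5 : a ≤ -2 := by omega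
        have h6 : (a:ℝ) ≤ -2 := by exact_mod_cast h5
        have h7 : (c:ℝ) = -1 := by exact_mod_cast c1
        linarith
      subst a1 c1
      push_cast at *
      have x0 : x < 0 := key x 0 (by push_cast; linarith)
      have bx : b < x := key b x (by linarith)
      have hbe : b = -e - 2 := by
        have h1 : (b:ℝ) < -e - 1 := by linarith
        have h2 : (-e - 1 : ℝ) - 1 < b + 1 := by linarith
        have h1' : b < -e - 1 := by exact_mod_cast h1
        have h2' : -e - 1 - 1 < b + 1 := by exact_mod_cast h2
        omega
      have xb2 : e - b + x < 0 := key _ 0 (by push_cast; linarith)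
      omega
  refine ⟨hb, ?_⟩
  have hbr : (b:ℝ) = -e - 1 := by exact_mod_cast hb
  rw [hbr] at hc1 hc2 hs1 hs2
  have hh : (a:ℝ) < l * (x + e + 1) ∧ l * (x + e + 1) ≤ a + 1 := by
    rcases le_or_gt 0 e with h | h
    · have := mono 0 e h
      push_cast at this
      constructor <;> linarith
    · have h1 := smono e 0 h
      have h2 := mono e (-1) (by omega)
      push_cast at h1 h2
      constructor <;> linarith
  have h1 : (c:ℝ) < -a := by linarith
  have h2 : (-a - 1 : ℝ) < c + 1 := by linarith
  have h1' : c < -a := by exact_mod_cast h1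
  have h2' : -a - 1 < c + 1 := by exact_mod_cast h2
  omega

/-- For every `r > 0` there is `λ* > 0` such that for all `0 < λ < λ*` and all
`z ∈ A(r,λ)`: if `z ∉ Λ` and `z ≠ (0,0)` then `v(z) = λ𝐰(z)`. -/
theorem vcond_of_not_transition (r : ℝ) (hr : 0 < r) :
    ∃ lamstar > (0:ℝ), ∀ lam : ℝ, 0 < lam → lam < lamstar →
      ∀ p ∈ Aset r lam, ¬ IsTransition lam p → p ≠ (0, 0) → vcond lam p := by
  refine ⟨1 / (r + 3), by positivity, fun l hl hlt p hp hnt hp0 => ?_⟩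
  obtain ⟨x, y⟩ := p
  have hlr : l * (r + 3) < 1 := by rwa [lt_div_iff₀ (by positivity)] at hlt
  simp only [Aset, Set.mem_ofPred_eq, max_lt_iff] at hp
  have hF : (Fe l ^ 4) (x, y) = Fe l (Fe l (Fe l (Fe l (x, y)))) := rfl
  have hFe : ∀ q : ℤ × ℤ, Fe l q = (⌊l * q.1⌋ - q.2, q.1) := fun _ => rfl
  simp only [IsTransition, not_not, Rmap, pt, hF, hFe, Prod.mk.injEq] at hnt
  obtain ⟨hs, ht⟩ := hnt
  simp only [vcond, wfield, pt, hF, hFe]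
  have hne : ¬ (x = 0 ∧ y = 0) := fun h => hp0 (by rw [h.1, h.2])
  have hga := Int.floor_le (l * x)
  have hga' := Int.lt_floor_add_one (l * x)
  generalize ⌊l * (x:ℝ)⌋ = a at *
  have hgb := Int.floor_le (l * ((a - y : ℤ) : ℝ))
  have hgb' := Int.lt_floor_add_one (l * ((a - y : ℤ) : ℝ))
  generalize ⌊l * ((a - y : ℤ) : ℝ)⌋ = b at *
  have hgc := Int.floor_le (l * ((b - x : ℤ) : ℝ))
  have hgc' := Int.lt_floor_add_one (l * ((b - x : ℤ) : ℝ))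
  generalize ⌊l * ((b - x : ℤ) : ℝ)⌋ = c at *
  have hge := Int.floor_le (l * y)
  have hge' := Int.lt_floor_add_one (l * y)
  rw [ht] at hs ⊢
  generalize ⌊l * (y:ℝ)⌋ = e at *
  rw [Int.floor_eq_iff] at hs ht
  push_cast at *
  obtain ⟨h1, h2⟩ := vcond_core l r hl hlr hr x y a b c e hp.1 hp.2 hne hga hga' hge hge'
    hgb hgb' hgc hgc' (by linarith [ht.1]) (by linarith [ht.2])
    (by linarith [hs.1]) (by linarith [hs.2])
  subst h1 h2
  ext
  · simp; ring
  · simp; ring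
end
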